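/- Every central subset of ℕ is dynamically central piecewise syndetic; every dynamically central piecewise syndetic set is dynamically piecewise syndetic; and a subset of ℕ is dynamically piecewise syndetic if and only if it is piecewise syndetic. Moreover both inclusions are strict: there is a dynamically central piecewise syndetic set that is not central, and a piecewise syndetic set that is not dynamically central piecewise syndetic. -/

import Mathlib

/-- The set `A - n`, difference taken inside the positive integers:
`A - n = {m : m >= 1 and m + n ∈ A}`. -/
def NSub (A : Set ℕ) (n : ℕ) : Set ℕ := {m : ℕ | 0 < m ∧ m + n ∈ A}

/-- `S ⊆ ℕ` is thick if every finite subset of `ℕ` has a translate inside `S`. -/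
def Thick (S : Set ℕ) : Prop :=
  ∀ F : Finset ℕ, ∃ n : ℕ, 0 < n ∧ ∀ f ∈ F, f + n ∈ S

/-- `S ⊆ ℕ` is piecewise syndetic if `⋃_{i=1}^{N} (S - i)` is thick for some `N ≥ 1`. -/
def PiecewiseSyndetic (S : Set ℕ) : Prop :=
  ∃ N : ℕ, 0 < N ∧ Thick (⋃ i ∈ Finset.Icc 1 N, NSub S i)

/-- A topological dynamical system: a nonempty compact metric space together with a
continuous self-map. -/
structure MetricDynSystem where
  carrier : Type
  [metric : MetricSpace carrier]
  [cpt : CompactSpace carrier]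
  [carrier_nonempty : Nonempty carrier]
  map : carrier → carrier
  continuous_map : Continuous map

attribute [instance] MetricDynSystem.metric MetricDynSystem.cpt MetricDynSystem.carrier_nonempty

/-- A system is minimal if every point has dense forward orbit `{T^n x : n ∈ ℕ}`. -/
def MetricDynSystem.Minimal (S : MetricDynSystem) : Prop :=
  ∀ x : S.carrier, Dense {y : S.carrier | ∃ n : ℕ, 0 < n ∧ S.map^[n] x = y}

/-- `R(x, U)`: the set of (positive) times at which `x` visits `U`. -/
def RetTimes (S : MetricDynSystem) (x : S.carrier) (U : Set S.carrier) : Set ℕ :=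
  {n : ℕ | 0 < n ∧ S.map^[n] x ∈ U}

/-- `A` is dynamically syndetic: it contains a set of return times `R(x, U)` for a
minimal system and a nonempty open `U`. -/
def DynSyndetic (A : Set ℕ) : Prop :=
  ∃ S : MetricDynSystem, S.Minimal ∧
    ∃ (x : S.carrier) (U : Set S.carrier), IsOpen U ∧ U.Nonempty ∧ RetTimes S x U ⊆ A

/-- `A` is dynamically central syndetic: it contains a set of return times `R(x, U)` for
a minimal system and an open `U` containing `x`. -/
def DynCentralSyndetic (A : Set ℕ) : Prop :=
  ∃ S : MetricDynSystem, S.Minimal ∧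
    ∃ (x : S.carrier) (U : Set S.carrier), IsOpen U ∧ x ∈ U ∧ RetTimes S x U ⊆ A

/-- `A` is dynamically thick: it intersects every dynamically syndetic set. -/
def DynThickDual (A : Set ℕ) : Prop := ∀ B : Set ℕ, DynSyndetic B → (A ∩ B).Nonempty

/-- `A` is a set of pointwise recurrence: it intersects every dynamically central
syndetic set. -/
def PointwiseRecurrentDual (A : Set ℕ) : Prop :=
  ∀ B : Set ℕ, DynCentralSyndetic B → (A ∩ B).Nonempty

/-- `A` is dynamically piecewise syndetic: the intersection of a dynamically syndetic
set and a dynamically thick set. -/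
def DynPiecewiseSyndetic (A : Set ℕ) : Prop :=
  ∃ B C : Set ℕ, DynSyndetic B ∧ DynThickDual C ∧ A = B ∩ C

/-- `A` is dynamically central piecewise syndetic: the intersection of a dynamically
central syndetic set and a set of pointwise recurrence. -/
def DynCentralPiecewiseSyndetic (A : Set ℕ) : Prop :=
  ∃ B C : Set ℕ, DynCentralSyndetic B ∧ PointwiseRecurrentDual C ∧ A = B ∩ C

/-- Addition on `βℕ`: `A ∈ p + q ↔ {n | A - n ∈ q} ∈ p`, where `A - n = {m | m + n ∈ A}`. -/
def uAdd (p q : Ultrafilter ℕ) : Ultrafilter ℕ :=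
  p.bind fun n => q.map fun m => m + n

/-- A left ideal of `(βℕ, +)`. -/
def IsLeftIdeal (L : Set (Ultrafilter ℕ)) : Prop :=
  L.Nonempty ∧ ∀ p : Ultrafilter ℕ, ∀ q ∈ L, uAdd p q ∈ L

/-- A minimal left ideal of `(βℕ, +)`. -/
def IsMinimalLeftIdeal (L : Set (Ultrafilter ℕ)) : Prop :=
  IsLeftIdeal L ∧ ∀ L' : Set (Ultrafilter ℕ), IsLeftIdeal L' → L' ⊆ L → L' = L

/-- A set is central if it belongs to some idempotent ultrafilter lying in a minimal
left ideal of `(βℕ, +)`. -/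
def Central (A : Set ℕ) : Prop :=
  ∃ p : Ultrafilter ℕ, uAdd p p = p ∧
    (∃ L : Set (Ultrafilter ℕ), IsMinimalLeftIdeal L ∧ p ∈ L) ∧ A ∈ p

section UltrafilterSemigroup

open Filter

attribute [local instance] Ultrafilter.addSemigroup

/-- A set of natural numbers has bounded gaps if it meets all intervals of some fixed length. -/
def BoundedGaps (S : Set ℕ) : Prop :=
  ∃ N : ℕ, ∀ c : ℕ, ∃ n ∈ S, c ≤ n ∧ n ≤ c + N

theorem BoundedGaps.mono {S T : Set ℕ} (hS : BoundedGaps S) (h : S ⊆ T) : BoundedGaps T := by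
  obtain ⟨N, hN⟩ := hS
  refine ⟨N, fun c => ?_⟩
  obtain ⟨n, hn, hc⟩ := hN c
  exact ⟨n, h hn, hc⟩

theorem uAdd_eq_add (p q : Ultrafilter ℕ) : uAdd p q = p + q := by
  refine Ultrafilter.coe_inj.mp (Filter.ext fun A => ?_)
  change (∀ᶠ n in (p : Filter ℕ), ∀ᶠ m in (q : Filter ℕ), m + n ∈ A) ↔
    ∀ᶠ n in (p : Filter ℕ), ∀ᶠ m in (q : Filter ℕ), n + m ∈ A
  simp only [add_comm]

theorem mem_ultrafilter_add {p q : Ultrafilter ℕ} {A : Set ℕ} :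
    A ∈ p + q ↔ {n : ℕ | {m : ℕ | n + m ∈ A} ∈ q} ∈ p :=
  Iff.rfl

theorem mem_pure_add {n : ℕ} {q : Ultrafilter ℕ} {A : Set ℕ} :
    A ∈ (pure n : Ultrafilter ℕ) + q ↔ {m : ℕ | n + m ∈ A} ∈ q := by
  rw [mem_ultrafilter_add]
  exact Iff.rfl

theorem isLeftIdeal_range_add (q : Ultrafilter ℕ) :
    IsLeftIdeal (Set.range fun p : Ultrafilter ℕ => p + q) := by
  refine ⟨⟨q + q, q, rfl⟩, ?_⟩
  rintro p _ ⟨r, rfl⟩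
  exact ⟨p + r, by rw [uAdd_eq_add]; exact add_assoc p r q⟩

theorem IsLeftIdeal.add_mem {L : Set (Ultrafilter ℕ)} (hL : IsLeftIdeal L) (p : Ultrafilter ℕ)
    {q : Ultrafilter ℕ} (hq : q ∈ L) : p + q ∈ L :=
  uAdd_eq_add p q ▸ hL.2 p q hq

theorem IsLeftIdeal.range_add_subset {L : Set (Ultrafilter ℕ)} (hL : IsLeftIdeal L)
    {q : Ultrafilter ℕ} (hq : q ∈ L) : (Set.range fun p : Ultrafilter ℕ => p + q) ⊆ L := by
  rintro _ ⟨p, rfl⟩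
  exact hL.add_mem p hq

theorem IsMinimalLeftIdeal.range_add_eq {L : Set (Ultrafilter ℕ)} (hL : IsMinimalLeftIdeal L)
    {q : Ultrafilter ℕ} (hq : q ∈ L) : (Set.range fun p : Ultrafilter ℕ => p + q) = L :=
  hL.2 _ (isLeftIdeal_range_add q) (hL.1.range_add_subset hq)

theorem isCompact_range_add (q : Ultrafilter ℕ) :
    IsCompact (Set.range fun p : Ultrafilter ℕ => p + q) :=
  isCompact_range (Ultrafilter.continuous_add_left q)

theorem IsMinimalLeftIdeal.isCompact {L : Set (Ultrafilter ℕ)} (hL : IsMinimalLeftIdeal L) :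
    IsCompact L := by
  obtain ⟨q, hq⟩ := hL.1.1
  exact hL.range_add_eq hq ▸ isCompact_range_add q

theorem IsMinimalLeftIdeal.exists_add_eq {L L' : Set (Ultrafilter ℕ)} (hL : IsMinimalLeftIdeal L)
    (hL' : IsLeftIdeal L') {q : Ultrafilter ℕ} (hq : q ∈ L) : ∃ p ∈ L', p + q = q := by
  have h : (fun p : Ultrafilter ℕ => p + q) '' L' = L := by
    refine hL.2 _ ⟨hL'.1.image _, ?_⟩ ?_
    · rintro p _ ⟨r, hr, rfl⟩
      exact ⟨p + r, hL'.add_mem p hr, by rw [uAdd_eq_add]; exact add_assoc p r q⟩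
    · rintro _ ⟨r, -, rfl⟩
      exact hL.1.add_mem r hq
  rwa [← h] at hq

theorem IsMinimalLeftIdeal.exists_idempotent {L : Set (Ultrafilter ℕ)}
    (hL : IsMinimalLeftIdeal L) : ∃ e ∈ L, e + e = e :=
  exists_idempotent_in_compact_add_subsemigroup Ultrafilter.continuous_add_left L hL.1.1
    hL.isCompact fun _ _ _ hy => hL.1.add_mem _ hy

theorem IsMinimalLeftIdeal.add_idempotent {L : Set (Ultrafilter ℕ)} (hL : IsMinimalLeftIdeal L)
    {e q : Ultrafilter ℕ} (he : e ∈ L) (hee : e + e = e) (hq : q ∈ L) : q + e = q := by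
  rw [← hL.range_add_eq he] at hq
  obtain ⟨p, rfl⟩ := hq
  change p + e + e = p + e
  rw [add_assoc, hee]

theorem exists_isMinimalLeftIdeal_subset (q : Ultrafilter ℕ) :
    ∃ L, IsMinimalLeftIdeal L ∧ L ⊆ Set.range fun p : Ultrafilter ℕ => p + q := by
  let S : Set (Set (Ultrafilter ℕ)) := {I | IsLeftIdeal I ∧ IsClosed I}
  have hS : ∀ r : Ultrafilter ℕ, (Set.range fun p : Ultrafilter ℕ => p + r) ∈ S := fun r =>
    ⟨isLeftIdeal_range_add r, (isCompact_range_add r).isClosed⟩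
  obtain ⟨L, hLsub, hL⟩ := zorn_superset_nonempty S (fun c hcS hc hcne => by
    refine ⟨⋂₀ c, ⟨⟨?_, fun p q hq => Set.mem_sInter.2 fun I hI =>
      (hcS hI).1.2 p q (Set.mem_sInter.1 hq I hI)⟩, isClosed_sInter fun I hI => (hcS hI).2⟩,
      fun I hI => Set.sInter_subset_of_mem hI⟩
    have : Nonempty c := hcne.coe_sort
    rw [Set.sInter_eq_iInter]
    exact IsCompact.nonempty_iInter_of_directed_nonempty_isCompact_isClosed _
      (DirectedOn.directed_val (IsChain.directedOn hc.symm)) (fun I => (hcS I.2).1.1)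
      (fun I => (hcS I.2).2.isCompact) (fun I => (hcS I.2).2)) _ (hS q)
  refine ⟨L, ⟨hL.prop.1, fun I hI hIL => ?_⟩, hLsub⟩
  obtain ⟨r, hr⟩ := hI.1
  have hrI := hI.range_add_subset hr
  exact hIL.antisymm ((hL.eq_of_subset (hS r) (hrI.trans hIL)) ▸ hrI)

theorem Thick.exists_isMinimalLeftIdeal {H : Set ℕ} (hH : Thick H) :
    ∃ L, IsMinimalLeftIdeal L ∧ ∀ q ∈ L, H ∈ q := by
  let f : ℕ → Filter ℕ := fun k => 𝓟 {m : ℕ | ∀ i ≤ k, i + m ∈ H}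
  have hf : Antitone f := fun k l hkl =>
    principal_mono.2 fun m hm i hi => hm i (hi.trans hkl)
  have hne : NeBot (⨅ k, f k) := iInf_neBot_of_directed' hf.directed_ge fun k => by
    obtain ⟨n, -, hn⟩ := hH (Finset.range (k + 1))
    exact principal_neBot_iff.2 ⟨n, fun i hi => hn i (Finset.mem_range.2 (by omega))⟩
  obtain ⟨L, hL, hLq⟩ := exists_isMinimalLeftIdeal_subset (Ultrafilter.of (⨅ k, f k))
  refine ⟨L, hL, fun q hq => ?_⟩
  obtain ⟨p, rfl⟩ := hLq hq
  refine mem_ultrafilter_add.2 (Filter.univ_mem' fun n => ?_)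
  exact Ultrafilter.of_le _ (mem_iInf_of_mem n fun m hm => hm n le_rfl)

theorem BoundedGaps.exists_mem {S : Set ℕ} (hS : BoundedGaps S) {L : Set (Ultrafilter ℕ)}
    (hL : IsLeftIdeal L) : ∃ q ∈ L, S ∈ q := by
  obtain ⟨N, hN⟩ := hS
  obtain ⟨q, hq⟩ := hL.1
  have h : (⋃ i ∈ Set.Iic N, {m : ℕ | i + m ∈ S}) ∈ q := Filter.univ_mem' fun c => by
    obtain ⟨n, hn, hcn, hnc⟩ := hN c
    simp only [Set.mem_iUnion]
    exact ⟨n - c, by simp; omega, by simpa [Nat.sub_add_cancel hcn] using hn⟩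
  obtain ⟨i, -, hi⟩ := (Ultrafilter.finite_biUnion_mem_iff (Set.finite_Iic N)).1 h
  exact ⟨pure i + q, hL.add_mem _ hq, mem_pure_add.2 hi⟩

theorem boundedGaps_of_forall_isMinimalLeftIdeal {S : Set ℕ}
    (h : ∀ L, IsMinimalLeftIdeal L → ∃ q ∈ L, S ∈ q) : BoundedGaps S := by
  by_contra hS
  have hthick : Thick Sᶜ := by
    intro F
    unfold BoundedGaps at hS
    push Not at hS
    obtain ⟨c, hc⟩ := hS (F.sup id + 1)
    refine ⟨c + 1, by omega, fun f hf hfS => ?_⟩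
    have : f ≤ F.sup id := Finset.le_sup (f := id) hf
    have := hc _ hfS (by omega)
    omega
  obtain ⟨L, hL, hLS⟩ := hthick.exists_isMinimalLeftIdeal
  obtain ⟨q, hq, hSq⟩ := h L hL
  exact Ultrafilter.compl_mem_iff_notMem.1 (hLS q hq) hSq

theorem IsMinimalLeftIdeal.boundedGaps {L : Set (Ultrafilter ℕ)} (hL : IsMinimalLeftIdeal L)
    {q : Ultrafilter ℕ} (hq : q ∈ L) {A : Set ℕ} (hA : A ∈ q) :
    BoundedGaps {n : ℕ | {m : ℕ | n + m ∈ A} ∈ q} := by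
  refine boundedGaps_of_forall_isMinimalLeftIdeal fun L' hL' => ?_
  obtain ⟨p, hp, hpq⟩ := hL.exists_add_eq hL'.1 hq
  exact ⟨p, hp, mem_ultrafilter_add.1 (hpq.symm ▸ hA)⟩

theorem piecewiseSyndetic_iff {A : Set ℕ} :
    PiecewiseSyndetic A ↔ ∃ L, IsMinimalLeftIdeal L ∧ ∃ q ∈ L, A ∈ q := by
  constructor
  · rintro ⟨N, -, hN⟩
    obtain ⟨L, hL, hLN⟩ := hN.exists_isMinimalLeftIdeal
    obtain ⟨q, hq⟩ := hL.1.1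
    obtain ⟨i, -, hi⟩ := (Ultrafilter.finite_biUnion_mem_iff
      (Finset.finite_toSet (Finset.Icc 1 N))).1 (hLN q hq)
    refine ⟨L, hL, pure i + q, hL.1.add_mem _ hq, mem_pure_add.2 ?_⟩
    filter_upwards [hi] with m hm
    exact add_comm m i ▸ hm.2
  · rintro ⟨L, hL, q, hq, hA⟩
    obtain ⟨N, hN⟩ := hL.boundedGaps hq hA
    refine ⟨N + 1, by omega, fun F => ?_⟩
    choose n hnA hn using hN
    have h : ∀ᶠ m in (q : Filter ℕ), ∀ f ∈ F, n (f + 2) + m ∈ A :=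
      (Finset.eventually_all F).2 fun f _ => hnA _
    obtain ⟨m, hm⟩ := h.exists
    refine ⟨m + 1, by omega, fun f hf => ?_⟩
    have := hn (f + 2)
    simp only [Set.mem_iUnion]
    refine ⟨n (f + 2) - f - 1, by simp; omega, by omega, ?_⟩
    convert hm f hf using 1
    omega

theorem add_self_dvd_mem {e : Ultrafilter ℕ} (he : e + e = e) (N : ℕ) [NeZero N] :
    {m : ℕ | N ∣ m} ∈ e := by
  obtain ⟨r, hr⟩ := (Ultrafilter.eventually_exists_iff (f := e)
    (P := fun (r : ZMod N) (m : ℕ) => (m : ZMod N) = r)).1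
      (Filter.Eventually.of_forall fun m => ⟨_, rfl⟩)
  have hr' : {n : ℕ | {m : ℕ | ((n + m : ℕ) : ZMod N) = r} ∈ e} ∈ e :=
    mem_ultrafilter_add.1 (he.symm ▸ hr)
  obtain ⟨n, hn, hnr⟩ := e.nonempty_of_mem (Filter.inter_mem hr' hr)
  obtain ⟨m, hm, hmr⟩ := e.nonempty_of_mem (Filter.inter_mem hn hr)
  have hr0 : r = 0 := by
    simp only [Set.mem_ofPred_eq] at hm hmr hnr
    push_cast at hm
    rw [hmr, hnr] at hm
    simpa using hm
  filter_upwards [hr] with m hm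
  exact (ZMod.natCast_eq_zero_iff m N).1 (hm.trans hr0)

end UltrafilterSemigroup

section UniformlyRecurrentSubset

/-- The word `w`, placed at position `a`, has all its `true` letters at positions in `D`. -/
def Fits (D : Set ℕ) (a : ℕ) (w : List Bool) : Prop :=
  ∀ i : ℕ, w[i]? = some true → a + i ∈ D

theorem fits_append {D : Set ℕ} {a : ℕ} {u v : List Bool} (hu : Fits D a u)
    (hv : Fits D (a + u.length) v) : Fits D a (u ++ v) := by
  intro i hi
  rcases lt_or_ge i u.length with h | h
  · exact hu i (by rwa [List.getElem?_append_left h] at hi)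
  · rw [List.getElem?_append_right h] at hi
    have := hv _ hi
    rwa [add_assoc, Nat.add_sub_cancel' h] at this

theorem fits_replicate_false (D : Set ℕ) (a l : ℕ) : Fits D a (List.replicate l false) := by
  intro i hi
  simp [List.getElem?_replicate] at hi

theorem boundedGaps_fits {D : Set ℕ}
    (hD : ∀ F : Finset ℕ, (F : Set ℕ) ⊆ D → BoundedGaps {n : ℕ | ∀ f ∈ F, n + f ∈ D})
    {w : List Bool} (hw : Fits D 0 w) : BoundedGaps {n : ℕ | Fits D n w} := by
  refine (hD ((Finset.range w.length).filter fun i => w[i]? = some true) fun i hi => ?_).mono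
    fun n hn i hi => hn i ?_
  · simpa using hw i (Finset.mem_filter.1 hi).2
  · refine Finset.mem_filter.2 ⟨Finset.mem_range.2 ?_, hi⟩
    exact (List.getElem?_eq_some_iff.1 hi).1

/-- The words that are concatenations of tiles `u ++ w` in `G` with `u` of length at most `M`. -/
inductive Tiled (G : Set (List Bool)) (w : List Bool) (M : ℕ) : List Bool → Prop
  | nil : Tiled G w M []
  | cons (u v : List Bool) (hM : u.length ≤ M) (hG : u ++ w ∈ G) (hv : Tiled G w M v) :
      Tiled G w M (u ++ w ++ v)

namespace Tiled

variable {G : Set (List Bool)} {w : List Bool} {M : ℕ}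

theorem append {u v : List Bool} (hu : Tiled G w M u) (hv : Tiled G w M v) :
    Tiled G w M (u ++ v) := by
  induction hu with
  | nil => exact hv
  | cons u u' hM hG _ ih => exact List.append_assoc (u ++ w) u' v ▸ cons u _ hM hG ih

theorem single {u : List Bool} (hM : u.length ≤ M) (hG : u ++ w ∈ G) : Tiled G w M (u ++ w) := by
  simpa using cons u [] hM hG nil

theorem mem {v : List Bool} (hv : Tiled G w M v) (hnil : [] ∈ G)
    (happend : ∀ u ∈ G, ∀ v ∈ G, u ++ v ∈ G) : v ∈ G := by
  induction hv with
  | nil => exact hnil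
  | cons u v _ hG _ ih => exact happend _ hG _ ih

theorem exists_drop {v : List Bool} (hv : Tiled G w M v) :
    ∀ c ≤ v.length, ∃ n, c ≤ n ∧ n ≤ c + (M + w.length) ∧ Tiled G w M (v.drop n) := by
  induction hv with
  | nil => exact fun c hc => ⟨c, le_rfl, by omega, by simpa using nil⟩
  | cons u v hM hG hv ih =>
    intro c hc
    rcases Nat.eq_zero_or_pos c with rfl | hc0
    · exact ⟨0, le_rfl, by omega, cons u v hM hG hv⟩
    rcases le_or_gt c (u ++ w).length with h | h
    · exact ⟨(u ++ w).length, h, by simp; omega, by rw [List.drop_left]; exact hv⟩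
    · rw [List.length_append] at hc
      obtain ⟨n, hn, hnc, ht⟩ := ih (c - (u ++ w).length) (by omega)
      refine ⟨(u ++ w).length + n, by omega, by omega, ?_⟩
      rwa [← List.drop_drop, List.drop_left]

theorem exists_prefix_drop {v : List Bool} (hv : Tiled G w M v) (hne : v ≠ []) :
    ∃ n ≤ M, w <+: v.drop n := by
  cases hv with
  | nil => exact absurd rfl hne
  | cons u v hM hG hv =>
    exact ⟨u.length, hM, by rw [List.append_assoc, List.drop_left]; exact List.prefix_append w v⟩

theorem exists_occurrence {v : List Bool} (hv : Tiled G w M v) (c : ℕ)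
    (hc : c + (2 * M + w.length + 1) ≤ v.length) :
    ∃ n, c ≤ n ∧ n ≤ c + (2 * M + w.length + 1) ∧ w <+: v.drop n := by
  obtain ⟨n, hcn, hnc, hn⟩ := hv.exists_drop c (by omega)
  obtain ⟨m, hm, hw⟩ := hn.exists_prefix_drop (by simp; omega)
  exact ⟨n + m, by omega, by omega, by rwa [List.drop_drop] at hw⟩

end Tiled

/-- A stage of the construction of a uniformly recurrent word supported in `D`: an initial word,
and a concatenation-closed class of words that can fill any interval up to an occurrence of
the initial word. -/
structure RecurrenceStage (D : Set ℕ) where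
  word : List Bool
  good : Set (List Bool)
  nil_mem : [] ∈ good
  append_mem : ∀ u ∈ good, ∀ v ∈ good, u ++ v ∈ good
  word_mem : word ∈ good
  word_ne_nil : word ≠ []
  fits : Fits D 0 word
  fill : ∀ a l : ℕ, ∃ u : List Bool, u.length = l ∧ Fits D a u ∧ u ++ word ∈ good

/-- The stage `s'` refines `s`, and the word of `s'` occurs with bounded gaps in its
good words. -/
structure RecurrenceStage.Refines {D : Set ℕ} (s' s : RecurrenceStage D) : Prop where
  word_initial : s.word <+: s'.word
  length_lt : s.word.length < s'.word.length
  good_subset : s'.good ⊆ s.good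
  recurrent : ∃ N : ℕ, ∀ v ∈ s'.good, ∀ c, c + N ≤ v.length →
    ∃ n, c ≤ n ∧ n ≤ c + N ∧ s'.word <+: v.drop n

theorem RecurrenceStage.exists_refines {D : Set ℕ}
    (hD : ∀ F : Finset ℕ, (F : Set ℕ) ⊆ D → BoundedGaps {n : ℕ | ∀ f ∈ F, n + f ∈ D})
    (s : RecurrenceStage D) : ∃ s' : RecurrenceStage D, s'.Refines s := by
  obtain ⟨p, hp, hwp⟩ : ∃ p, Fits D p s.word ∧ s.word.length ≤ p := by
    obtain ⟨N, hN⟩ := boundedGaps_fits hD s.fits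
    obtain ⟨p, hp, hwp, -⟩ := hN s.word.length
    exact ⟨p, hp, hwp⟩
  obtain ⟨u₀, hu₀, hu₀D, hu₀s⟩ := s.fill s.word.length (p - s.word.length)
  set w := s.word ++ (u₀ ++ s.word) with hw
  have hwD : Fits D 0 w := by
    refine fits_append s.fits (fits_append (by simpa using hu₀D) ?_)
    rwa [hu₀, zero_add, Nat.add_sub_cancel' hwp]
  have hgood : ∀ u, u ++ s.word ∈ s.good → u ++ w ∈ s.good := fun u hu => by
    rw [hw, ← List.append_assoc]
    exact s.append_mem _ hu _ hu₀s
  obtain ⟨N, hN⟩ := boundedGaps_fits hD hwD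
  have hwpos : 0 < w.length := by
    simp [hw, List.length_pos_iff.2 s.word_ne_nil]
  have hfill : ∀ l a : ℕ, ∃ u : List Bool, u.length = l ∧ Fits D a u ∧
      Tiled s.good w (N + w.length) (u ++ w) := by
    intro l
    induction l using Nat.strong_induction_on with
    | _ l ih =>
      intro a
      rcases le_or_gt l (N + w.length) with hl | hl
      · obtain ⟨u, hul, huD, hus⟩ := s.fill a l
        exact ⟨u, hul, huD, .single (by omega) (hgood u hus)⟩
      · obtain ⟨m, hmD, ham, hma⟩ := hN a
        obtain ⟨u, hul, huD, hus⟩ := s.fill a (m - a)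
        obtain ⟨v, hvl, hvD, hv⟩ := ih (l - (m - a + w.length)) (by omega)
          (a + (m - a + w.length))
        refine ⟨u ++ w ++ v, by simp; omega, ?_, ?_⟩
        · refine fits_append (fits_append huD ?_) (by rwa [List.length_append, hul])
          rwa [hul, Nat.add_sub_cancel' ham]
        · rw [List.append_assoc]
          exact .cons u _ (by omega) (hgood u hus) hv
  refine ⟨⟨w, {v | Tiled s.good w (N + w.length) v}, .nil, fun u hu v hv => hu.append hv, ?_,
    List.length_pos_iff.1 hwpos, hwD, fun a l => hfill l a⟩, ?_, ?_, ?_, _, fun v hv c hc =>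
    hv.exists_occurrence c hc⟩
  · exact .single (u := []) (by simp) (hgood [] s.word_mem)
  · exact List.prefix_append _ _
  · have := List.length_pos_iff.2 s.word_ne_nil
    simp [hw]
    omega
  · exact fun v hv => hv.mem s.nil_mem s.append_mem

theorem exists_uniformlyRecurrent_subset {D : Set ℕ}
    (hD : ∀ F : Finset ℕ, (F : Set ℕ) ⊆ D → BoundedGaps {n : ℕ | ∀ f ∈ F, n + f ∈ D})
    {d : ℕ} (hd : d ∈ D) :
    ∃ z : ℕ → Bool, (∀ n, z n = true → n ∈ D) ∧ z d = true ∧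
      ∀ k, BoundedGaps {n : ℕ | ∀ i < k, z (n + i) = z i} := by
  choose next hnext using RecurrenceStage.exists_refines hD
  let s₀ : RecurrenceStage D :=
    { word := List.replicate d false ++ [true]
      good := Set.univ
      nil_mem := trivial
      append_mem := fun _ _ _ _ => trivial
      word_mem := trivial
      word_ne_nil := by simp
      fits := fits_append (fits_replicate_false D 0 d) fun i hi => by
        rcases i with _ | i <;> simp_all
      fill := fun a l => ⟨List.replicate l false, by simp, fits_replicate_false D a l, trivial⟩ }
  let s : ℕ → RecurrenceStage D := fun k => next^[k] s₀
  have hs : ∀ k, (s (k + 1)).Refines (s k) := fun k => by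
    simp only [s, Function.iterate_succ_apply']
    exact hnext _
  have hlen : ∀ k, k + d < (s k).word.length := by
    intro k
    induction k with
    | zero => simp [s, s₀]
    | succ k ih => have := (hs k).length_lt; omega
  have hinit : ∀ k l, k ≤ l → (s k).word <+: (s l).word := fun k l hkl =>
    Nat.le_induction (List.prefix_refl _) (fun l _ ih => ih.trans (hs l).word_initial) l hkl
  have hgood : ∀ k l, k ≤ l → (s l).good ⊆ (s k).good := fun k l hkl =>
    Nat.le_induction subset_rfl (fun l _ ih => (hs l).good_subset.trans ih) l hkl
  let z : ℕ → Bool := fun i => (s i).word[i]'(by have := hlen i; omega)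
  have hz : ∀ k i, i < (s k).word.length → (s k).word[i]? = some (z i) := by
    intro k i hi
    have hi' : i < (s i).word.length := by have := hlen i; omega
    rcases le_total i k with h | h
    · exact List.prefix_iff_getElem?.1 (hinit i k h) i hi'
    · rw [List.getElem?_eq_getElem hi, Option.some_inj, ← Option.some_inj,
        ← List.prefix_iff_getElem?.1 (hinit k i h) i hi, List.getElem?_eq_getElem hi']
  refine ⟨z, fun n hn => ?_, ?_, fun k => ?_⟩
  · have := (s n).fits n (by rw [hz n n (by have := hlen n; omega), hn])
    simpa using this
  · have := hz 0 d (by have := hlen 0; omega)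
    simpa [s, s₀] using this.symm
  · obtain ⟨N, hN⟩ := (hs k).recurrent
    refine ⟨N, fun c => ?_⟩
    have hj := hlen (max (k + 1) (c + N))
    obtain ⟨n, hcn, hnc, hn⟩ := hN _ (hgood (k + 1) (max (k + 1) (c + N)) (le_max_left _ _)
      (s (max (k + 1) (c + N))).word_mem) c (by omega)
    refine ⟨n, fun i hi => ?_, hcn, hnc⟩
    have hik : i < (s (k + 1)).word.length := by have := hlen (k + 1); omega
    have h1 := List.prefix_iff_getElem?.1 hn i hik
    rw [List.getElem?_drop, ← List.getElem?_eq_getElem hik, hz _ _ hik] at h1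
    have h2 := hz _ _ (List.getElem?_eq_some_iff.1 h1).1
    exact Option.some_inj.1 (h2.symm.trans h1)

end UniformlyRecurrentSubset

section SymbolicSystems

theorem exists_forall_eq_imp_mem {W : Set (ℕ → Bool)} (hW : IsOpen W) {z : ℕ → Bool}
    (hz : z ∈ W) : ∃ k : ℕ, ∀ y : ℕ → Bool, (∀ i < k, y i = z i) → y ∈ W := by
  obtain ⟨I, u, hu, hIu⟩ := isOpen_pi_iff.1 hW z hz
  refine ⟨I.sup id + 1, fun y hy => hIu fun i hi => ?_⟩
  rw [hy i (Nat.lt_succ_of_le (Finset.le_sup (f := id) hi))]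
  exact (hu i hi).2

/-- A uniformly recurrent point of the full shift generates a minimal system. -/
theorem exists_minimal_of_uniformlyRecurrent {z : ℕ → Bool}
    (hz : ∀ k, BoundedGaps {n : ℕ | ∀ i < k, z (n + i) = z i}) :
    ∃ S : MetricDynSystem, S.Minimal ∧ ∃ (x : S.carrier) (U : Set S.carrier), IsOpen U ∧
      ∀ n, S.map^[n] x ∈ U ↔ z n = true := by
  let shift : (ℕ → Bool) → ℕ → Bool := fun y i => y (i + 1)
  have hshift : Continuous shift := continuous_pi fun i => continuous_apply (i + 1)
  have hiter : ∀ (n : ℕ) (y : ℕ → Bool), shift^[n] y = fun i => y (i + n) := by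
    intro n
    induction n with
    | zero => exact fun y => rfl
    | succ n ih =>
      intro y
      rw [Function.iterate_succ_apply, ih]
      exact funext fun i => congrArg y (by omega)
  let Y : Set (ℕ → Bool) := closure (Set.range fun n => shift^[n] z)
  have hY : Set.MapsTo shift Y Y := by
    refine Set.MapsTo.closure ?_ hshift
    rintro _ ⟨n, rfl⟩
    exact ⟨n + 1, Function.iterate_succ_apply' shift n z⟩
  have hzY : z ∈ Y := subset_closure ⟨0, rfl⟩
  have hYc : CompactSpace Y := isCompact_iff_compactSpace.1 isClosed_closure.isCompact
  have hYn : Nonempty Y := ⟨⟨z, hzY⟩⟩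
  let S : MetricDynSystem :=
    { carrier := Y
      metric := TopologicalSpace.metrizableSpaceMetric Y
      cpt := hYc
      carrier_nonempty := hYn
      map := hY.restrict
      continuous_map := hshift.restrict hY }
  have hSiter : ∀ (n : ℕ) (y : Y), ((S.map^[n] y : Y) : ℕ → Bool) = shift^[n] y.1 := by
    intro n y
    exact hY.iterate_restrict n ▸ rfl
  refine ⟨S, fun y => dense_iff_inter_open.2 ?_, (⟨z, hzY⟩ : Y),
    {y : Y | y.1 0 = true}, ?_, fun n => ?_⟩
  · rintro _ ⟨W, hW, rfl⟩ ⟨t, ht⟩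
    obtain ⟨_, hmW, m, rfl⟩ := mem_closure_iff.1 t.2 W hW ht
    obtain ⟨k, hk⟩ := exists_forall_eq_imp_mem (hW.preimage (hshift.iterate m)) hmW
    obtain ⟨N, hN⟩ := hz k
    have hclosed : IsClosed (⋃ n ∈ Finset.Icc 1 (N + 1),
        {y : ℕ → Bool | ∀ i < k, y (i + n) = z i}) := by
      refine isClosed_biUnion_finset fun n _ => ?_
      simp only [Set.ofPred_forall]
      exact isClosed_iInter fun i => isClosed_iInter fun _ =>
        isClosed_eq (continuous_apply _) continuous_const
    have hsub : Y ⊆ _ := closure_minimal (by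
      rintro _ ⟨c, rfl⟩
      obtain ⟨n, hn, hcn, hnc⟩ := hN (c + 1)
      simp only [Set.mem_iUnion]
      refine ⟨n - c, Finset.mem_Icc.2 ⟨by omega, by omega⟩, fun i hi => ?_⟩
      rw [hiter, ← hn i hi]
      exact congrArg z (by omega)) hclosed
    obtain ⟨n, hn, hny⟩ := Set.mem_iUnion₂.1 (hsub y.2)
    refine ⟨S.map^[n + m] y, ?_, n + m, by have := (Finset.mem_Icc.1 hn).1; omega, rfl⟩
    change ((S.map^[n + m] y : Y) : ℕ → Bool) ∈ W
    rw [hSiter, add_comm, Function.iterate_add_apply]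
    exact hk _ fun i hi => by rw [hiter]; exact hny i hi
  · have h : Continuous fun y : Y => y.1 0 := (continuous_apply 0).comp continuous_subtype_val
    exact (isOpen_discrete ({true} : Set Bool)).preimage h
  · change ((S.map^[n] (⟨z, hzY⟩ : Y) : Y) : ℕ → Bool) 0 = true ↔ _
    rw [hSiter, hiter]
    change z (0 + n) = true ↔ _
    rw [zero_add]

end SymbolicSystems

section ReturnTimes

attribute [local instance] Ultrafilter.addSemigroup

theorem MetricDynSystem.Minimal.boundedGaps_retTimes {S : MetricDynSystem} (hS : S.Minimal)
    (x : S.carrier) {V : Set S.carrier} (hV : IsOpen V) (hne : V.Nonempty) :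
    BoundedGaps (RetTimes S x V) := by
  obtain ⟨t, ht⟩ := isCompact_univ.elim_finite_subcover
    (fun n : ℕ => S.map^[n + 1] ⁻¹' V) (fun n => hV.preimage (S.continuous_map.iterate _))
    fun y _ => by
      obtain ⟨_, hyV, n, hn, rfl⟩ := (hS y).inter_open_nonempty V hV hne
      exact Set.mem_iUnion.2 ⟨n - 1, by rwa [Set.mem_preimage, Nat.sub_add_cancel hn]⟩
  refine ⟨t.sup id + 1, fun c => ?_⟩
  obtain ⟨n, hn, hnV⟩ := Set.mem_iUnion₂.1 (ht (Set.mem_univ (S.map^[c] x)))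
  have : n ≤ t.sup id := Finset.le_sup (f := id) hn
  refine ⟨n + 1 + c, ⟨by omega, ?_⟩, by omega, by omega⟩
  rw [Function.iterate_add_apply]
  exact hnV

theorem DynCentralSyndetic.dynSyndetic {A : Set ℕ} (hA : DynCentralSyndetic A) :
    DynSyndetic A := by
  obtain ⟨S, hS, x, U, hU, hx, hA⟩ := hA
  exact ⟨S, hS, x, U, hU, ⟨x, hx⟩, hA⟩

theorem DynSyndetic.boundedGaps {A : Set ℕ} (hA : DynSyndetic A) : BoundedGaps A := by
  obtain ⟨S, hS, x, U, hU, hne, hA⟩ := hA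
  exact (hS.boundedGaps_retTimes x hU hne).mono hA

theorem DynThickDual.pointwiseRecurrentDual {C : Set ℕ} (hC : DynThickDual C) :
    PointwiseRecurrentDual C :=
  fun B hB => hC B hB.dynSyndetic

theorem dynThickDual_of_forall_mem {L : Set (Ultrafilter ℕ)} (hL : IsLeftIdeal L) {C : Set ℕ}
    (hC : ∀ q ∈ L, C ∈ q) : DynThickDual C := by
  intro B hB
  obtain ⟨q, hq, hBq⟩ := hB.boundedGaps.exists_mem hL
  exact q.nonempty_of_mem (Filter.inter_mem (hC q hq) hBq)

theorem MetricDynSystem.Minimal.exists_idempotent {S : MetricDynSystem} (hS : S.Minimal)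
    (x : S.carrier) {L : Set (Ultrafilter ℕ)} (hL : IsMinimalLeftIdeal L) :
    ∃ e ∈ L, e + e = e ∧ ∀ V : Set S.carrier, IsOpen V → x ∈ V → RetTimes S x V ∈ e := by
  let ι := {V : Set S.carrier // IsOpen V ∧ x ∈ V}
  let K : ι → Set (Ultrafilter ℕ) := fun V => L ∩ {q | RetTimes S x V.1 ∈ q}
  have hKcl : ∀ V, IsClosed (K V) := fun V =>
    hL.isCompact.isClosed.inter (ultrafilter_isClosed_basic _)
  have hKne : (⋂ V, K V).Nonempty := by
    have : Nonempty ι := ⟨⟨Set.univ, isOpen_univ, trivial⟩⟩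
    refine IsCompact.nonempty_iInter_of_directed_nonempty_isCompact_isClosed K ?_ (fun V => ?_)
      (fun V => (hKcl V).isCompact) hKcl
    · intro V W
      refine ⟨⟨V.1 ∩ W.1, V.2.1.inter W.2.1, V.2.2, W.2.2⟩, ?_, ?_⟩
      · exact fun q hq => ⟨hq.1, Filter.mem_of_superset hq.2 fun n hn => ⟨hn.1, hn.2.1⟩⟩
      · exact fun q hq => ⟨hq.1, Filter.mem_of_superset hq.2 fun n hn => ⟨hn.1, hn.2.2⟩⟩
    · exact (hS.boundedGaps_retTimes x V.2.1 ⟨x, V.2.2⟩).exists_mem hL.1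
  obtain ⟨e, he, hee⟩ := exists_idempotent_in_compact_add_subsemigroup
    Ultrafilter.continuous_add_left (⋂ V, K V) hKne (isClosed_iInter hKcl).isCompact
    fun p hp q hq => by
      rw [Set.mem_iInter] at hp hq ⊢
      intro V
      refine ⟨hL.1.add_mem p (hq V).1, mem_ultrafilter_add.2 ?_⟩
      filter_upwards [(hp V).2] with n hn
      filter_upwards [(hq ⟨S.map^[n] ⁻¹' V.1, V.2.1.preimage (S.continuous_map.iterate n),
        hn.2⟩).2] with m hm
      refine ⟨by have := hn.1; omega, ?_⟩
      rw [Function.iterate_add_apply]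
      exact hm.2
  rw [Set.mem_iInter] at he
  exact ⟨e, (he ⟨Set.univ, isOpen_univ, trivial⟩).1, hee, fun V hV hx => (he ⟨V, hV, hx⟩).2⟩

theorem MetricDynSystem.exists_minimal_retTimes_subset {S : MetricDynSystem} {x : S.carrier}
    {U : Set S.carrier} (hU : IsOpen U) {E : Set ℕ}
    (hE : ∀ L, IsMinimalLeftIdeal L → ∃ q ∈ L,
      (∀ V : Set S.carrier, IsOpen V → x ∈ V → RetTimes S x V ∈ q) ∧
        ∀ f, f = 0 ∨ f ∈ E → {n : ℕ | f + n ∈ E} ∈ q)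
    {d : ℕ} (hd : S.map^[d] x ∈ U) (hdE : d = 0 ∨ d ∈ E) :
    ∃ S' : MetricDynSystem, S'.Minimal ∧ ∃ (x' : S'.carrier) (U' : Set S'.carrier), IsOpen U' ∧
      S'.map^[d] x' ∈ U' ∧ RetTimes S' x' U' ⊆ RetTimes S x U ∩ E := by
  let D : Set ℕ := {n | S.map^[n] x ∈ U ∧ (n = 0 ∨ n ∈ E)}
  obtain ⟨z, hzD, hzd, hz⟩ := exists_uniformlyRecurrent_subset (D := D) (fun F hF => by
    refine boundedGaps_of_forall_isMinimalLeftIdeal fun L hL => ?_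
    obtain ⟨q, hq, hqV, hqE⟩ := hE L hL
    refine ⟨q, hq, (Finset.eventually_all F).2 fun f hf => ?_⟩
    filter_upwards [hqV _ (hU.preimage (S.continuous_map.iterate f)) (hF hf).1,
      hqE f (hF hf).2] with n hn hnE
    refine ⟨?_, Or.inr (add_comm f n ▸ hnE)⟩
    rw [add_comm, Function.iterate_add_apply]
    exact hn.2) (d := d) ⟨hd, hdE⟩
  obtain ⟨S', hS', x', U', hU', hn⟩ := exists_minimal_of_uniformlyRecurrent hz
  refine ⟨S', hS', x', U', hU', (hn d).2 hzd, fun n hnU => ?_⟩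
  obtain ⟨hnU', hnE⟩ := hzD n ((hn n).1 hnU.2)
  exact ⟨⟨hnU.1, hnU'⟩, hnE.resolve_left hnU.1.ne'⟩

end ReturnTimes

section Relations

attribute [local instance] Ultrafilter.addSemigroup

/-- A minimal system and a set large along every minimal left ideal have compatible
return times. -/
theorem exists_mem_of_forall_isMinimalLeftIdeal_mem {S : MetricDynSystem} (hS : S.Minimal)
    (x : S.carrier) {E : Set ℕ} (hE : ∀ L, IsMinimalLeftIdeal L → ∀ q ∈ L, E ∈ q)
    (L : Set (Ultrafilter ℕ)) (hL : IsMinimalLeftIdeal L) : ∃ q ∈ L,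
      (∀ V : Set S.carrier, IsOpen V → x ∈ V → RetTimes S x V ∈ q) ∧
        ∀ f, f = 0 ∨ f ∈ E → {n : ℕ | f + n ∈ E} ∈ q := by
  obtain ⟨e, he, -, heV⟩ := hS.exists_idempotent x hL
  exact ⟨e, he, heV, fun f _ => mem_pure_add.1 (hE L hL _ (hL.1.add_mem (pure f) he))⟩

theorem compl_mem_of_not_piecewiseSyndetic {A : Set ℕ} (hA : ¬ PiecewiseSyndetic A)
    (L : Set (Ultrafilter ℕ)) (hL : IsMinimalLeftIdeal L) (q : Ultrafilter ℕ) (hq : q ∈ L) :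
    Aᶜ ∈ q :=
  Ultrafilter.compl_mem_iff_notMem.2 fun h => hA (piecewiseSyndetic_iff.2 ⟨L, hL, q, hq, h⟩)

theorem DynPiecewiseSyndetic.piecewiseSyndetic {A : Set ℕ} (hA : DynPiecewiseSyndetic A) :
    PiecewiseSyndetic A := by
  obtain ⟨B, C, ⟨S, hS, x, U, hU, hne, hB⟩, hC, rfl⟩ := hA
  by_contra hA
  have hE := compl_mem_of_not_piecewiseSyndetic hA
  obtain ⟨L, hL, -⟩ := exists_isMinimalLeftIdeal_subset (pure 0)
  obtain ⟨q, hq, hqU⟩ := (hS.boundedGaps_retTimes x hU hne).exists_mem hL.1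
  obtain ⟨d, hdU, hdE⟩ := q.nonempty_of_mem (Filter.inter_mem hqU (hE L hL q hq))
  obtain ⟨S', hS', x', U', hU', hd, hsub⟩ := MetricDynSystem.exists_minimal_retTimes_subset hU
    (exists_mem_of_forall_isMinimalLeftIdeal_mem hS x hE) hdU.2 (Or.inr hdE)
  obtain ⟨n, hnC, hn⟩ := hC _ ⟨S', hS', x', U', hU', ⟨_, hd⟩, hsub⟩
  exact hn.2 ⟨hB hn.1, hnC⟩

theorem DynCentralPiecewiseSyndetic.piecewiseSyndetic {A : Set ℕ}
    (hA : DynCentralPiecewiseSyndetic A) : PiecewiseSyndetic A := by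
  obtain ⟨B, C, ⟨S, hS, x, U, hU, hx, hB⟩, hC, rfl⟩ := hA
  by_contra hA
  have hE := compl_mem_of_not_piecewiseSyndetic hA
  obtain ⟨S', hS', x', U', hU', hd, hsub⟩ := MetricDynSystem.exists_minimal_retTimes_subset
    (d := 0) hU (exists_mem_of_forall_isMinimalLeftIdeal_mem hS x hE) hx (Or.inl rfl)
  obtain ⟨n, hnC, hn⟩ := hC _ ⟨S', hS', x', U', hU', hd, hsub⟩
  exact hn.2 ⟨hB hn.1, hnC⟩

open Classical in
/-- A member of an ultrafilter in a minimal left ideal is the intersection of a dynamically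
syndetic set and a set that is large along the whole ideal. -/
theorem IsMinimalLeftIdeal.exists_eq_inter {L : Set (Ultrafilter ℕ)} (hL : IsMinimalLeftIdeal L)
    {e q : Ultrafilter ℕ} (he : e ∈ L) (hee : e + e = e) (hq : q ∈ L) {A : Set ℕ} (hA : A ∈ q) :
    ∃ B C : Set ℕ, A = B ∩ C ∧ (∀ q ∈ L, C ∈ q) ∧ DynSyndetic B ∧
      (A ∈ e → DynCentralSyndetic B) := by
  let z : ℕ → Bool := fun n => decide ({m : ℕ | n + m ∈ A} ∈ e)
  have hz : ∀ k, BoundedGaps {n : ℕ | ∀ i < k, z (n + i) = z i} := by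
    refine fun k => boundedGaps_of_forall_isMinimalLeftIdeal fun L' hL' => ?_
    obtain ⟨p, hp, hpe⟩ := hL.exists_add_eq hL'.1 he
    have h : ∀ᶠ n in (p : Filter ℕ), ∀ i ∈ Finset.range k, z (n + i) = z i := by
      refine (Finset.eventually_all _).2 fun i _ => ?_
      by_cases hi : {m : ℕ | i + m ∈ A} ∈ e
      · have hi' := hi
        rw [← hpe, mem_ultrafilter_add] at hi'
        filter_upwards [hi'] with n hn
        simp only [z, decide_eq_decide, hi, iff_true]
        filter_upwards [hn] with m hm
        rwa [add_comm n i, add_assoc]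
      · have hi' := Ultrafilter.compl_mem_iff_notMem.2 hi
        rw [← hpe, mem_ultrafilter_add] at hi'
        filter_upwards [hi'] with n hn
        simp only [z, decide_eq_decide, hi, iff_false]
        rw [← Ultrafilter.compl_mem_iff_notMem]
        filter_upwards [hn] with m hm
        rw [Set.mem_compl_iff, Set.mem_ofPred_eq] at hm ⊢
        rwa [add_comm n i, add_assoc]
    refine ⟨p, hp, ?_⟩
    filter_upwards [h] with n hn i hi using hn i (Finset.mem_range.2 hi)
  obtain ⟨S, hS, x, U, hU, hn⟩ := exists_minimal_of_uniformlyRecurrent hz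
  simp only [z, decide_eq_true_eq] at hn
  refine ⟨A ∪ RetTimes S x U, A ∪ (RetTimes S x U)ᶜ, ?_, fun r hr => ?_, ?_, fun hAe => ?_⟩
  · rw [← Set.union_inter_distrib_left, Set.inter_compl_self, Set.union_empty]
  · by_cases hAr : A ∈ r
    · exact Filter.mem_of_superset hAr Set.subset_union_left
    · rw [← Ultrafilter.compl_mem_iff_notMem, ← hL.add_idempotent he hee hr,
        mem_ultrafilter_add] at hAr
      filter_upwards [hAr] with n hnA
      exact Or.inr fun h => Ultrafilter.compl_mem_iff_notMem.1 hnA ((hn n).1 h.2)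
  · rw [← hL.add_idempotent he hee hq, mem_ultrafilter_add] at hA
    obtain ⟨n, hnA⟩ := q.nonempty_of_mem hA
    exact ⟨S, hS, x, U, hU, ⟨_, (hn n).2 hnA⟩, Set.subset_union_right⟩
  · exact ⟨S, hS, x, U, hU, (hn 0).2 (by simpa using hAe), Set.subset_union_right⟩

theorem PiecewiseSyndetic.dynPiecewiseSyndetic {A : Set ℕ} (hA : PiecewiseSyndetic A) :
    DynPiecewiseSyndetic A := by
  obtain ⟨L, hL, q, hq, hAq⟩ := piecewiseSyndetic_iff.1 hA
  obtain ⟨e, he, hee⟩ := hL.exists_idempotent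
  obtain ⟨B, C, hBC, hC, hB, -⟩ := hL.exists_eq_inter he hee hq hAq
  exact ⟨B, C, hB, dynThickDual_of_forall_mem hL.1 hC, hBC⟩

theorem Central.dynCentralPiecewiseSyndetic {A : Set ℕ} (hA : Central A) :
    DynCentralPiecewiseSyndetic A := by
  obtain ⟨e, hee, ⟨L, hL, he⟩, hAe⟩ := hA
  rw [uAdd_eq_add] at hee
  obtain ⟨B, C, hBC, hC, -, hB⟩ := hL.exists_eq_inter he hee he hAe
  exact ⟨B, C, hB hAe, (dynThickDual_of_forall_mem hL.1 hC).pointwiseRecurrentDual, hBC⟩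

end Relations

section Examples

attribute [local instance] Ultrafilter.addSemigroup

theorem dynCentralSyndetic_univ : DynCentralSyndetic Set.univ := by
  obtain ⟨S, hS, x, U, hU, hn⟩ := exists_minimal_of_uniformlyRecurrent (z := fun _ => true)
    fun _ => ⟨0, fun c => ⟨c, fun _ _ => rfl, le_rfl, le_rfl⟩⟩
  exact ⟨S, hS, x, U, hU, (hn 0).2 rfl, Set.subset_univ _⟩

/-- The union of the intervals `[2 ^ t, 2 ^ t + t)` over the codes `t` of pairs with
first entry `k`. -/
def codedIntervals (k : ℕ) : Set ℕ :=
  {n | ∃ t : ℕ, t.unpair.1 = k ∧ 2 ^ t ≤ n ∧ n < 2 ^ t + t}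

theorem thick_codedIntervals (k : ℕ) : Thick (codedIntervals k) := by
  intro F
  refine ⟨2 ^ Nat.pair k (F.sup id + 1), by positivity, fun f hf =>
    ⟨Nat.pair k (F.sup id + 1), by simp, by omega, ?_⟩⟩
  have : f ≤ F.sup id := Finset.le_sup (f := id) hf
  have := Nat.right_le_pair k (F.sup id + 1)
  omega

/-- The numbers in `codedIntervals k` whose 2-adic valuation is `k`, for some `k`. -/
def codedValuationSet : Set ℕ :=
  {n | ∃ k, n ∈ codedIntervals k ∧ 2 ^ k ∣ n ∧ ¬ 2 ^ (k + 1) ∣ n}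

theorem pointwiseRecurrentDual_codedValuationSet :
    PointwiseRecurrentDual codedValuationSet := by
  rintro B ⟨S, hS, x, U, hU, hx, hB⟩
  obtain ⟨N, hN⟩ := hS.boundedGaps_retTimes x hU ⟨x, hx⟩
  obtain ⟨n, hn, -⟩ := hN 0
  obtain ⟨k, a, ha, hna⟩ := Nat.exists_eq_pow_mul_and_not_dvd hn.1.ne' 2 (by norm_num)
  obtain ⟨L, hL, hLk⟩ := (thick_codedIntervals k).exists_isMinimalLeftIdeal
  obtain ⟨e, he, hee, heV⟩ := hS.exists_idempotent x hL
  have hek := mem_pure_add.1 (hLk _ (hL.1.add_mem (pure n) he))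
  obtain ⟨m, ⟨hmk, hm⟩, hmn⟩ := e.nonempty_of_mem (Filter.inter_mem (Filter.inter_mem hek
    (heV _ (hU.preimage (S.continuous_map.iterate n)) hn.2)) (add_self_dvd_mem hee (2 ^ (k + 1))))
  refine ⟨n + m, ⟨k, hmk, ?_, ?_⟩, hB ⟨by have := hn.1; omega, ?_⟩⟩
  · exact dvd_add ⟨a, hna⟩ ((pow_dvd_pow 2 k.le_succ).trans hmn)
  · rw [← Nat.dvd_add_iff_left hmn, hna, pow_succ]
    exact fun h => ha (Nat.dvd_of_mul_dvd_mul_left (by positivity) h)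
  · rw [Function.iterate_add_apply]
    exact hm.2

theorem not_central_codedValuationSet : ¬ Central codedValuationSet := by
  rintro ⟨p, hpp, -, hp⟩
  rw [uAdd_eq_add] at hpp
  have hp' := hp
  rw [← hpp, mem_ultrafilter_add] at hp'
  obtain ⟨n, hn, k, ⟨t, -, htn, -⟩, -⟩ := p.nonempty_of_mem (Filter.inter_mem hp' hp)
  have hn0 : 0 < n := lt_of_lt_of_le (by positivity) htn
  obtain ⟨m, ⟨hnm, hm⟩, hdvd⟩ := p.nonempty_of_mem (Filter.inter_mem (Filter.inter_mem hn hp)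
    (add_self_dvd_mem hpp (2 ^ (n + 2))))
  obtain ⟨l, ⟨s, hsl, hsm, hms⟩, hlm, hlm'⟩ := hm
  obtain ⟨l', ⟨s', hsl', hsm', hms'⟩, hlm'', -⟩ := hnm
  have hlt : ∀ a : ℕ, a < 2 ^ a := fun a => Nat.lt_two_pow_self
  have hm0 : 0 < m := lt_of_lt_of_le (by positivity) hsm
  have hns : n + 2 < s + 1 := by
    refine (Nat.pow_lt_pow_iff_right (a := 2) (by norm_num)).1 ?_
    have := Nat.le_of_dvd hm0 hdvd
    have := hlt s
    rw [pow_succ 2 s]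
    omega
  have hss' : s' ≤ s := by
    refine Nat.lt_succ_iff.1 ((Nat.pow_lt_pow_iff_right (a := 2) (by norm_num)).1 ?_)
    obtain ⟨r, rfl⟩ : ∃ r, s = r + 1 := ⟨s - 1, by omega⟩
    have := hlt r
    simp only [Nat.succ_eq_add_one, pow_succ] at *
    omega
  have hs's : s ≤ s' := by
    refine Nat.lt_succ_iff.1 ((Nat.pow_lt_pow_iff_right (a := 2) (by norm_num)).1 ?_)
    have := hlt s'
    simp only [Nat.succ_eq_add_one, pow_succ 2 s']
    omega
  obtain rfl : s' = s := le_antisymm hss' hs's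
  obtain rfl : l' = l := hsl'.symm.trans hsl
  have hln := Nat.le_of_dvd hn0 ((Nat.dvd_add_iff_left hlm).2 hlm'')
  have := hlt l'
  exact hlm' ((pow_dvd_pow 2 (by omega)).trans hdvd)

theorem dynCentralPiecewiseSyndetic_codedValuationSet :
    DynCentralPiecewiseSyndetic codedValuationSet :=
  ⟨Set.univ, codedValuationSet, dynCentralSyndetic_univ,
    pointwiseRecurrentDual_codedValuationSet, (Set.univ_inter _).symm⟩

theorem piecewiseSyndetic_odd : PiecewiseSyndetic {n : ℕ | ¬ 2 ∣ n} := by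
  refine ⟨2, by norm_num, fun F => ⟨1, by norm_num, fun f _ => ?_⟩⟩
  simp only [Set.mem_iUnion]
  by_cases h : 2 ∣ f
  · exact ⟨2, by simp, by omega, by simp only [Set.mem_ofPred_eq]; omega⟩
  · exact ⟨1, by simp, by omega, by simp only [Set.mem_ofPred_eq]; omega⟩

theorem not_dynCentralPiecewiseSyndetic_odd :
    ¬ DynCentralPiecewiseSyndetic {n : ℕ | ¬ 2 ∣ n} := by
  rintro ⟨B, C, ⟨S, hS, x, U, hU, hx, hB⟩, hC, hBC⟩
  obtain ⟨S', hS', x', U', hU', hx', hsub⟩ := MetricDynSystem.exists_minimal_retTimes_subset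
    (E := {n : ℕ | 2 ∣ n}) (d := 0) hU (fun L hL => by
      obtain ⟨e, he, hee, heV⟩ := hS.exists_idempotent x hL
      refine ⟨e, he, heV, fun f hf => ?_⟩
      filter_upwards [add_self_dvd_mem hee 2] with n hn
      have hf' : 2 ∣ f := hf.elim (fun h => h ▸ dvd_zero 2) id
      exact dvd_add hf' hn) hx (Or.inl rfl)
  obtain ⟨n, hnC, hn⟩ := hC _ ⟨S', hS', x', U', hU', hx', hsub⟩
  have : n ∈ {n : ℕ | ¬ 2 ∣ n} := hBC ▸ ⟨hB hn.1, hnC⟩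
  exact this hn.2

end Examples

theorem central_dcps_dps_ps_relations :
    (∀ A : Set ℕ, Central A → DynCentralPiecewiseSyndetic A) ∧
    (∀ A : Set ℕ, DynCentralPiecewiseSyndetic A → DynPiecewiseSyndetic A) ∧
    (∀ A : Set ℕ, DynPiecewiseSyndetic A ↔ PiecewiseSyndetic A) ∧
    (∃ A : Set ℕ, DynCentralPiecewiseSyndetic A ∧ ¬ Central A) ∧
    (∃ A : Set ℕ, PiecewiseSyndetic A ∧ ¬ DynCentralPiecewiseSyndetic A) :=
  ⟨fun _ hA => hA.dynCentralPiecewiseSyndetic,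
    fun _ hA => hA.piecewiseSyndetic.dynPiecewiseSyndetic,
    fun _ => ⟨fun hA => hA.piecewiseSyndetic, fun hA => hA.dynPiecewiseSyndetic⟩,
    ⟨_, dynCentralPiecewiseSyndetic_codedValuationSet, not_central_codedValuationSet⟩,
    ⟨_, piecewiseSyndetic_odd, not_dynCentralPiecewiseSyndetic_odd⟩⟩
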